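/- (Case III is impossible) There is no point x* ∈ Δ^7 with F†(x*) = α† such that f_j(x*) = α† for every j ∈ {1,2,3,4,5,6} and f_7(x*) < α†, f_8(x*) < α†. -/

import Mathlib

noncomputable def sigD (t : ℝ) : ℝ := (1 - t) / t

def DeltaSeven : Set (Fin 8 → ℝ) := {x | (∀ i, 0 < x i) ∧ ∑ i, x i = 1}

noncomputable def fD (x : Fin 8 → ℝ) : Fin 8 → ℝ :=
  ![sigD (x 3 + x 4 + x 5) * sigD (x 0),
    sigD (x 3 + x 4 + x 5 + x 6 + x 7) * sigD (x 1),
    sigD (x 0 + x 1 + x 2 + x 6 + x 7) * sigD (x 2),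
    sigD (x 0 + x 1 + x 2) * sigD (x 3),
    sigD (x 0 + x 1 + x 2 + x 6 + x 7) * sigD (x 4),
    sigD (x 3 + x 4 + x 5 + x 6 + x 7) * sigD (x 5),
    sigD (x 3 + x 4 + x 5) * sigD (x 6),
    sigD (x 0 + x 1 + x 2) * sigD (x 7)]

noncomputable def FD (x : Fin 8 → ℝ) : ℝ :=
  Finset.univ.sup' Finset.univ_nonempty (fD x)

noncomputable def alphaD : ℝ := sInf (FD '' DeltaSeven)

open Filter Topology in
theorem quad_neg (c k : ℝ) (hc : c < 0) : ∀ᶠ e in 𝓝[>] (0:ℝ), e * c + e ^ 2 * k < 0 := by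
  have h : Tendsto (fun e : ℝ => c + e * k) (𝓝 0) (𝓝 (c + 0 * k)) := by
    apply Continuous.tendsto (f := fun e : ℝ => c + e * k); fun_prop
  rw [zero_mul, add_zero] at h
  have h1 := (h.eventually (gt_mem_nhds hc)).filter_mono (nhdsWithin_le_nhds (s := Set.Ioi 0))
  filter_upwards [h1, self_mem_nhdsWithin] with e he hpos
  have : 0 < e := hpos
  nlinarith

open Filter Topology in
theorem pos_near (a d : ℝ) (ha : 0 < a) : ∀ᶠ e in 𝓝[>] (0:ℝ), 0 < a + e * d := by
  have h : Tendsto (fun e : ℝ => a + e * d) (𝓝 0) (𝓝 (a + 0 * d)) := by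
    apply Continuous.tendsto (f := fun e : ℝ => a + e * d); fun_prop
  rw [zero_mul, add_zero] at h
  exact (h.eventually (lt_mem_nhds ha)).filter_mono nhdsWithin_le_nhds

theorem sigD_pos {t : ℝ} (h0 : 0 < t) (h1 : t < 1) : 0 < sigD t :=
  div_pos (by linarith) h0

theorem sigD_lt_iff {s t : ℝ} (hs : 0 < s) (ht : 0 < t) : sigD s < sigD t ↔ t < s := by
  unfold sigD
  rw [div_lt_div_iff₀ hs ht]
  constructor <;> intro h <;> nlinarith

theorem sigD_inj {s t : ℝ} (hs : 0 < s) (ht : 0 < t) (h : sigD s = sigD t) : s = t := by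
  unfold sigD at h
  rw [div_eq_div_iff hs.ne' ht.ne'] at h
  linarith

open Filter Topology in
set_option maxHeartbeats 4000000 in
theorem perturb (x1 x2 x3 x4 x5 x6 x7 x8 al : ℝ)
    (p1 : 0 < x1) (p2 : 0 < x2) (p3 : 0 < x3) (p4 : 0 < x4) (p5 : 0 < x5) (p6 : 0 < x6)
    (p7 : 0 < x7) (p8 : 0 < x8) (hs : x1 + x2 + x3 + x4 + x5 + x6 + x7 + x8 = 1)
    (hA : x1 + x2 + x3 < 1 / 2)
    (f1 : sigD (x4 + x5 + x6) * sigD x1 = al)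
    (f2 : sigD (x4 + x5 + x6 + x7 + x8) * sigD x2 = al)
    (f3 : sigD (x1 + x2 + x3 + x7 + x8) * sigD x3 = al)
    (f4 : sigD (x1 + x2 + x3) * sigD x4 = al)
    (f5 : sigD (x1 + x2 + x3 + x7 + x8) * sigD x5 = al)
    (f6 : sigD (x4 + x5 + x6 + x7 + x8) * sigD x6 = al)
    (f7 : sigD (x4 + x5 + x6) * sigD x7 < al)
    (f8 : sigD (x1 + x2 + x3) * sigD x8 < al) :
    ∃ y1 y2 y3 y4 y5 y6 y7 y8 : ℝ, 0 < y1 ∧ 0 < y2 ∧ 0 < y3 ∧ 0 < y4 ∧ 0 < y5 ∧ 0 < y6 ∧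
      0 < y7 ∧ 0 < y8 ∧ y1 + y2 + y3 + y4 + y5 + y6 + y7 + y8 = 1 ∧
      sigD (y4 + y5 + y6) * sigD y1 < al ∧
      sigD (y4 + y5 + y6 + y7 + y8) * sigD y2 < al ∧
      sigD (y1 + y2 + y3 + y7 + y8) * sigD y3 < al ∧
      sigD (y1 + y2 + y3) * sigD y4 < al ∧
      sigD (y1 + y2 + y3 + y7 + y8) * sigD y5 < al ∧
      sigD (y4 + y5 + y6 + y7 + y8) * sigD y6 < al ∧
      sigD (y4 + y5 + y6) * sigD y7 < al ∧
      sigD (y1 + y2 + y3) * sigD y8 < al := by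
  obtain ⟨A, hAd⟩ : ∃ A, A = x1 + x2 + x3 := ⟨_, rfl⟩
  obtain ⟨B, hBd⟩ : ∃ B, B = x4 + x5 + x6 := ⟨_, rfl⟩
  have e1 : x4 + x5 + x6 + x7 + x8 = 1 - A := by linarith
  have e2 : x1 + x2 + x3 + x7 + x8 = 1 - B := by linarith
  rw [e1] at f2 f6
  rw [e2] at f3 f5
  rw [← hBd] at f1 f7
  rw [← hAd] at f4 f8 hA
  have hA0 : 0 < A := by linarith
  have hB0 : 0 < B := by linarith
  have hB1 : B < 1 := by linarith
  have sA := sigD_pos hA0 (by linarith)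
  have sA' := sigD_pos (t := 1 - A) (by linarith) (by linarith)
  have sB := sigD_pos hB0 (by linarith)
  have sB' := sigD_pos (t := 1 - B) (by linarith) (by linarith)
  have h62 : x6 = x2 := sigD_inj p6 p2 (mul_left_cancel₀ sA'.ne' (f6.trans f2.symm))
  have h48 : x4 < x8 := by
    rw [← f4] at f8
    exact (sigD_lt_iff p8 p4).1 (lt_of_mul_lt_mul_left f8 sA.le)
  have h24 : x2 < x4 := by
    rw [← sigD_lt_iff p4 p2]
    have hlt : sigD (1 - A) < sigD A := (sigD_lt_iff (by linarith) hA0).2 (by linarith)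
    have := sigD_pos p4 (by linarith)
    by_contra hcon
    push Not at hcon
    have h1 : sigD (1 - A) * sigD x2 ≤ sigD (1 - A) * sigD x4 :=
      mul_le_mul_of_nonneg_left hcon sA'.le
    have h2 : sigD (1 - A) * sigD x4 < sigD A * sigD x4 := mul_lt_mul_of_pos_right hlt this
    linarith
  have v24 : x2 * (1 - x2) < x4 * (1 - x4) := by
    nlinarith [mul_pos (sub_pos.2 h24) (show 0 < 1 - x2 - x4 by linarith)]
  have v2A : x2 * (1 - x2) < A * (1 - A) := by
    nlinarith [mul_pos (show 0 < A - x2 by linarith) (show 0 < 1 - x2 - A by linarith)]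
  obtain ⟨q, hq⟩ : ∃ q, q = A * (1 - A) := ⟨_, rfl⟩
  obtain ⟨n, hn0, hn1, hn2⟩ : ∃ n : ℝ, 0 < n ∧ x2 * (1 - x2) + n < A * (1 - A) ∧
      x2 * (1 - x2) + 2 * n < x4 * (1 - x4) := by
    refine ⟨min (A * (1 - A) - x2 * (1 - x2)) (x4 * (1 - x4) - x2 * (1 - x2)) / 3, ?_, ?_, ?_⟩
    · have := lt_min (sub_pos.2 v2A) (sub_pos.2 v24); linarith
    · have := min_le_left (A * (1 - A) - x2 * (1 - x2)) (x4 * (1 - x4) - x2 * (1 - x2)); linarith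
    · have := min_le_right (A * (1 - A) - x2 * (1 - x2)) (x4 * (1 - x4) - x2 * (1 - x2)); linarith
  obtain ⟨p, hp⟩ : ∃ p, p = x2 * (1 - x2) + n := ⟨_, rfl⟩
  have hpq : p < q := by linarith
  have hp0 : 0 < p := by nlinarith
  have hq0 : 0 < q := by linarith
  have g2 := quad_neg (q * (x2 * (1 - A) * (1 - x2) + A * (1 - x2) * x2)
      - p * (A * x2 * (1 - A) + (1 - x2) * A * (1 - A)))
      (-p * q * x2 * (1 - A) + (1 - x2) * A * p * q) (by
    have : q * (x2 * (1 - A) * (1 - x2) + A * (1 - x2) * x2)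
      - p * (A * x2 * (1 - A) + (1 - x2) * A * (1 - A)) = -n * (A * (1 - A)) := by
      rw [hp, hq]; ring
    rw [this]; rw [← hq]; nlinarith)
  have g4 := quad_neg ((p + n) * (A * (1 - A)) - q * (x4 * (1 - x4)))
      (-q * (p + n) * A * x4 + (1 - A) * (1 - x4) * q * (p + n)) (by
    rw [← hq]; nlinarith)
  have c7 : ∀ᶠ e in 𝓝[>] (0:ℝ), sigD B * sigD (x7 + e * (-q)) < al := by
    have h : ContinuousAt (fun e : ℝ => sigD B * sigD (x7 + e * (-q))) 0 := by
      unfold sigD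
      have : x7 + 0 * (-q) ≠ 0 := by simpa using p7.ne'
      fun_prop (disch := assumption)
    have h' := h.tendsto
    have h0 : sigD B * sigD (x7 + 0 * (-q)) < al := by simpa using f7
    exact (h'.eventually (gt_mem_nhds h0)).filter_mono nhdsWithin_le_nhds
  have c4 := pos_near x4 (-(p + n)) p4
  have c77 := pos_near x7 (-q) p7
  obtain ⟨e, ⟨⟨⟨⟨g2, g4⟩, c7⟩, c4⟩, c77⟩, he⟩ :=
    (((((g2.and g4).and c7).and c4).and c77).and
      (self_mem_nhdsWithin : ∀ᶠ e in 𝓝[>] (0:ℝ), e ∈ Set.Ioi 0)).exists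
  have he : 0 < e := he
  have hep := mul_pos he hp0
  have heq := mul_pos he hq0
  have hen := mul_pos he hn0
  have hed := mul_pos he (sub_pos.2 hpq)
  have hA' : x1 + e * ((q - p) / 2) + (x2 + e * p) + (x3 + e * ((q - p) / 2)) = A + e * q := by
    rw [hAd]; ring
  have hB' : x4 + e * (-(p + n)) + (x5 + e * n) + (x6 + e * p) = B := by
    rw [hBd]; ring
  have hA1 : x4 + e * (-(p + n)) + (x5 + e * n) + (x6 + e * p) + (x7 + e * (-q)) + x8
      = 1 - (A + e * q) := by
    rw [hB', hBd]; linarith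
  have hB1' : x1 + e * ((q - p) / 2) + (x2 + e * p) + (x3 + e * ((q - p) / 2))
      + (x7 + e * (-q)) + x8 = 1 - B := by
    rw [hA']; linarith
  have key2 : sigD (1 - (A + e * q)) * sigD (x2 + e * p) < al := by
    rw [← f2]
    unfold sigD
    rw [div_mul_div_comm, div_mul_div_comm, div_lt_div_iff₀ (mul_pos (by linarith) (by linarith))
      (mul_pos (by linarith) p2)]
    linarith only [g2]
  refine ⟨x1 + e * ((q - p) / 2), x2 + e * p, x3 + e * ((q - p) / 2), x4 + e * (-(p + n)),
    x5 + e * n, x6 + e * p, x7 + e * (-q), x8, by linarith, by linarith, by linarith, c4,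
    by linarith, by linarith, c77, p8, by linarith, ?_⟩
  rw [hA1, hB1', hA', hB']
  refine ⟨?_, key2, ?_, ?_, ?_, ?_, c7, ?_⟩
  · rw [← f1]
    exact mul_lt_mul_of_pos_left ((sigD_lt_iff (by linarith) p1).2 (by linarith)) sB
  · rw [← f3]
    exact mul_lt_mul_of_pos_left ((sigD_lt_iff (by linarith) p3).2 (by linarith)) sB'
  · rw [← f4]
    unfold sigD
    rw [div_mul_div_comm, div_mul_div_comm, div_lt_div_iff₀ (mul_pos (by linarith) c4)
      (mul_pos hA0 p4)]
    linarith only [g4]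
  · rw [← f5]
    exact mul_lt_mul_of_pos_left ((sigD_lt_iff (by linarith) p5).2 (by linarith)) sB'
  · rw [h62]; exact key2
  · refine lt_trans ?_ f8
    exact mul_lt_mul_of_pos_right ((sigD_lt_iff (by linarith) hA0).2 (by linarith))
      (sigD_pos p8 (by linarith))

theorem alphaD_le (y : Fin 8 → ℝ) (hy : y ∈ DeltaSeven) : alphaD ≤ FD y := by
  refine csInf_le ⟨0, ?_⟩ ⟨y, hy, rfl⟩
  rintro _ ⟨x, ⟨hp, hs⟩, rfl⟩
  refine le_trans ?_ (Finset.le_sup' (fD x) (Finset.mem_univ 0))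
  rw [Fin.sum_univ_eight] at hs
  have h := hp
  have h0 := h 0; have h1 := h 1; have h2 := h 2; have h3 := h 3
  have h4 := h 4; have h5 := h 5; have h6 := h 6; have h7 := h 7
  exact (mul_pos (sigD_pos (by linarith) (by linarith)) (sigD_pos h0 (by linarith))).le

theorem no_better (y1 y2 y3 y4 y5 y6 y7 y8 : ℝ)
    (h : 0 < y1 ∧ 0 < y2 ∧ 0 < y3 ∧ 0 < y4 ∧ 0 < y5 ∧ 0 < y6 ∧
      0 < y7 ∧ 0 < y8 ∧ y1 + y2 + y3 + y4 + y5 + y6 + y7 + y8 = 1 ∧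
      sigD (y4 + y5 + y6) * sigD y1 < alphaD ∧
      sigD (y4 + y5 + y6 + y7 + y8) * sigD y2 < alphaD ∧
      sigD (y1 + y2 + y3 + y7 + y8) * sigD y3 < alphaD ∧
      sigD (y1 + y2 + y3) * sigD y4 < alphaD ∧
      sigD (y1 + y2 + y3 + y7 + y8) * sigD y5 < alphaD ∧
      sigD (y4 + y5 + y6 + y7 + y8) * sigD y6 < alphaD ∧
      sigD (y4 + y5 + y6) * sigD y7 < alphaD ∧
      sigD (y1 + y2 + y3) * sigD y8 < alphaD) : False := by
  obtain ⟨p1, p2, p3, p4, p5, p6, p7, p8, hs, f1, f2, f3, f4, f5, f6, f7, f8⟩ := h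
  have hm : ![y1, y2, y3, y4, y5, y6, y7, y8] ∈ DeltaSeven := by
    constructor
    · intro i
      fin_cases i <;> assumption
    · rw [Fin.sum_univ_eight]; exact hs
  refine absurd (alphaD_le _ hm) (not_le.2 ?_)
  unfold FD
  rw [Finset.sup'_lt_iff]
  intro i _
  fin_cases i <;> assumption

theorem stmt9 :
    ¬ ∃ x ∈ DeltaSeven, FD x = alphaD ∧
      fD x 0 = alphaD ∧ fD x 1 = alphaD ∧ fD x 2 = alphaD ∧
      fD x 3 = alphaD ∧ fD x 4 = alphaD ∧ fD x 5 = alphaD ∧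
      fD x 6 < alphaD ∧ fD x 7 < alphaD := by
  rintro ⟨x, ⟨hp, hs⟩, -, f1, f2, f3, f4, f5, f6, f7, f8⟩
  rw [Fin.sum_univ_eight] at hs
  have h := hp
  have h0 := h 0; have h1 := h 1; have h2 := h 2; have h3 := h 3
  have h4 := h 4; have h5 := h 5; have h6 := h 6; have h7 := h 7
  change sigD (x 3 + x 4 + x 5) * sigD (x 0) = _ at f1
  change sigD (x 3 + x 4 + x 5 + x 6 + x 7) * sigD (x 1) = _ at f2
  change sigD (x 0 + x 1 + x 2 + x 6 + x 7) * sigD (x 2) = _ at f3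
  change sigD (x 0 + x 1 + x 2) * sigD (x 3) = _ at f4
  change sigD (x 0 + x 1 + x 2 + x 6 + x 7) * sigD (x 4) = _ at f5
  change sigD (x 3 + x 4 + x 5 + x 6 + x 7) * sigD (x 5) = _ at f6
  change sigD (x 3 + x 4 + x 5) * sigD (x 6) < _ at f7
  change sigD (x 0 + x 1 + x 2) * sigD (x 7) < _ at f8
  by_cases hA : x 0 + x 1 + x 2 < 1 / 2
  · obtain ⟨y1, y2, y3, y4, y5, y6, y7, y8, hy⟩ := perturb _ _ _ _ _ _ _ _ _
      h0 h1 h2 h3 h4 h5 h6 h7 hs hA f1 f2 f3 f4 f5 f6 f7 f8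
    exact no_better _ _ _ _ _ _ _ _ hy
  · rw [add_right_comm _ (x 6) (x 7)] at f2 f3 f5 f6
    obtain ⟨y1, y2, y3, y4, y5, y6, y7, y8, q1, q2, q3, q4, q5, q6, q7, q8, hy, g1, g2, g3, g4,
        g5, g6, g7, g8⟩ := perturb _ _ _ _ _ _ _ _ _
      h3 h4 h5 h0 h1 h2 h7 h6 (by linarith) (by linarith) f4 f5 f6 f1 f2 f3 f8 f7
    rw [add_right_comm _ y7 y8] at g2 g3 g5 g6
    exact no_better y4 y5 y6 y1 y2 y3 y8 y7 ⟨q4, q5, q6, q1, q2, q3, q8, q7, by linarith,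
      g4, g5, g6, g1, g2, g3, g8, g7⟩
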